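/- For p : I → k let N(p) be the sum of all A-submodules S of P(p) with S ∩ P(p)_p = 0, and let L(p) := P(p)/N(p). Then L(p) is a simple A-module whose weight space L(p)_p is one-dimensional over k, and every simple weight A-module M with M_p ≠ 0 is isomorphic to L(p) as an A-module. -/

import Mathlib

set_option synthInstance.maxHeartbeats 1000000
set_option maxHeartbeats 4000000

noncomputable section

open MvPolynomial

universe u v

variable (k : Type u) (I : Type v) [Field k]

/-- Multiplication by the variable `x i` on the polynomial algebra `B`. -/
def Xop (i : I) : Module.End k (MvPolynomial I k) :=
  LinearMap.mulLeft k (MvPolynomial.X i)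

/-- The partial derivative `∂/∂x i` on the polynomial algebra `B`. -/
def Yop (i : I) : Module.End k (MvPolynomial I k) :=
  (MvPolynomial.pderiv i).toLinearMap

/-- The infinite Weyl algebra `A`: the subalgebra of `Module.End k B` generated by
all `X i` and `Y i`. -/
def Weyl : Subalgebra k (Module.End k (MvPolynomial I k)) :=
  Algebra.adjoin k (Set.range (Xop k I) ∪ Set.range (Yop k I))

instance : Ring (Weyl k I) := inferInstance
instance : Algebra k (Weyl k I) := inferInstance

/-- `X i` as an element of the Weyl algebra. -/
def XA (i : I) : Weyl k I :=
  ⟨Xop k I i, Algebra.subset_adjoin (Set.mem_union_left _ ⟨i, rfl⟩)⟩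

/-- `Y i` as an element of the Weyl algebra. -/
def YA (i : I) : Weyl k I :=
  ⟨Yop k I i, Algebra.subset_adjoin (Set.mem_union_right _ ⟨i, rfl⟩)⟩

/-- `t i = X i * Y i` as an element of the Weyl algebra. -/
def tA (i : I) : Weyl k I := XA k I i * YA k I i

/-- Shortcut instance: quotients of the Weyl algebra by left ideals (submodules). -/
instance : HasQuotient (Weyl k I) (Submodule (Weyl k I) (Weyl k I)) :=
  @Submodule.hasQuotient (Weyl k I) (Weyl k I) _ _ _

/-- The weight space of weight `p` in a module over the Weyl algebra:
all `x` with `t i • x = p i • x` for every `i`. -/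
def wtSp (M : Type*) [AddCommGroup M] [Module k M] [Module (Weyl k I) M]
    [IsScalarTower k (Weyl k I) M] (p : I → k) : Submodule k M where
  carrier := {x | ∀ i, tA k I i • x = p i • x}
  add_mem' := by
    intro a b ha hb i
    rw [smul_add, ha i, hb i, ← smul_add]
  zero_mem' := by intro i; rw [smul_zero, smul_zero]
  smul_mem' := by
    intro c x hx i
    have h : tA k I i • (c • x) = c • (tA k I i • x) := by
      rw [← algebraMap_smul (Weyl k I) c x, ← algebraMap_smul (Weyl k I) c (tA k I i • x),
        smul_smul, smul_smul, Algebra.commutes]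
    rw [h, hx i, smul_smul, smul_smul, mul_comm]

/-- The left ideal `J_p` of the Weyl algebra generated by the elements `t i - p i • 1`. -/
def Jp (p : I → k) : Submodule (Weyl k I) (Weyl k I) :=
  Submodule.span (Weyl k I) (Set.range fun i => tA k I i - p i • (1 : Weyl k I))

instance (p : I → k) : Module k (Weyl k I ⧸ Jp k I p) := inferInstance
instance (p : I → k) : IsScalarTower k (Weyl k I) (Weyl k I ⧸ Jp k I p) := inferInstance

/-- The sum `N(p)` of all submodules of `P(p)` intersecting the weight space `P(p)_p`
trivially. -/
def Np (p : I → k) : Submodule (Weyl k I) (Weyl k I ⧸ Jp k I p) :=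
  sSup {S : Submodule (Weyl k I) (Weyl k I ⧸ Jp k I p) |
    ∀ x ∈ S, x ∈ wtSp k I (Weyl k I ⧸ Jp k I p) p → x = 0}

instance (p : I → k) :
    HasQuotient (Weyl k I ⧸ Jp k I p) (Submodule (Weyl k I) (Weyl k I ⧸ Jp k I p)) :=
  @Submodule.hasQuotient (Weyl k I) (Weyl k I ⧸ Jp k I p) _ _ _

/-- The module `L(p) = P(p) ⧸ N(p)`. -/
abbrev Lp (p : I → k) := (Weyl k I ⧸ Jp k I p) ⧸ Np k I p

universe w

section Action

variable {k I}

theorem Weyl.induction {C : Weyl k I → Prop} (hX : ∀ i, C (XA k I i)) (hY : ∀ i, C (YA k I i))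
    (algebraMap : ∀ c : k, C (algebraMap k (Weyl k I) c))
    (add : ∀ a b, C a → C b → C (a + b)) (mul : ∀ a b, C a → C b → C (a * b))
    (a : Weyl k I) : C a := by
  obtain ⟨a, ha⟩ := a
  induction ha using Algebra.adjoin_induction with
  | mem x hx =>
    rcases hx with ⟨i, rfl⟩ | ⟨i, rfl⟩
    exacts [hX i, hY i]
  | algebraMap c => exact algebraMap c
  | add x y hx hy h₁ h₂ => exact add ⟨x, hx⟩ ⟨y, hy⟩ h₁ h₂
  | mul x y hx hy h₁ h₂ => exact mul ⟨x, hx⟩ ⟨y, hy⟩ h₁ h₂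

theorem Weyl.ext_monomial {a b : Weyl k I}
    (h : ∀ n, a.1 (monomial n 1) = b.1 (monomial n 1)) : a = b :=
  Subtype.ext <| (basisMonomials I k).ext fun n => by simpa using h n

theorem XA_apply_monomial (i : I) (n : I →₀ ℕ) (c : k) :
    (XA k I i).1 (monomial n c) = monomial (n + Finsupp.single i 1) c := by
  simp [XA, Xop, X, monomial_mul, add_comm]

theorem YA_apply_monomial (i : I) (n : I →₀ ℕ) (c : k) :
    (YA k I i).1 (monomial n c) = monomial (n - Finsupp.single i 1) (c * n i) := by
  simp [YA, Yop, pderiv_monomial]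

theorem tA_apply_monomial (i : I) (n : I →₀ ℕ) (c : k) :
    (tA k I i).1 (monomial n c) = monomial n (c * n i) := by
  change (XA k I i).1 ((YA k I i).1 (monomial n c)) = _
  rw [YA_apply_monomial, XA_apply_monomial]
  by_cases h : n i = 0
  · simp [h]
  · rw [tsub_add_cancel_of_le]
    simpa [Finsupp.single_le_iff] using Nat.one_le_iff_ne_zero.2 h

theorem coeff_tA_apply (i : I) (n : I →₀ ℕ) (f : MvPolynomial I k) :
    coeff n ((tA k I i).1 f) = n i * coeff n f := by
  classical
  induction f using MvPolynomial.induction_on' with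
  | monomial m c =>
    rw [tA_apply_monomial, coeff_monomial, coeff_monomial]
    split_ifs with h
    · rw [h, mul_comm]
    · rw [mul_zero]
  | add f g hf hg => rw [map_add, coeff_add, coeff_add, hf, hg, mul_add]

/-- The coefficient of the Laurent monomial of exponent `z`; it vanishes unless `z ≥ 0`. -/
def laurentCoeff (z : I → ℤ) : MvPolynomial I k →ₗ[k] k :=
  open Classical in
  (basisMonomials I k).constr k fun n => if (fun i => (n i : ℤ)) = z then 1 else 0

open Classical in
theorem laurentCoeff_monomial (z : I → ℤ) (n : I →₀ ℕ) (c : k) :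
    laurentCoeff z (monomial n c) = if (fun i => (n i : ℤ)) = z then c else 0 := by
  have h := (basisMonomials I k).constr_basis k
    (fun n => if (fun i => (n i : ℤ)) = z then (1 : k) else 0) n
  rw [coe_basisMonomials] at h
  have h' : (monomial n c : MvPolynomial I k) = c • monomial n 1 := by simp [smul_monomial]
  rw [h', map_smul, laurentCoeff, h]
  simp

theorem laurentCoeff_natCast (n : I →₀ ℕ) (f : MvPolynomial I k) :
    laurentCoeff (fun i => (n i : ℤ)) f = coeff n f := by
  classical
  induction f using MvPolynomial.induction_on' with
  | monomial m c =>
    rw [laurentCoeff_monomial, coeff_monomial]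
    simp [funext_iff, Finsupp.ext_iff]
  | add f g hf hg => rw [map_add, coeff_add, hf, hg]

open Classical in
theorem laurentCoeff_XA (i : I) (z : I → ℤ) (f : MvPolynomial I k) :
    laurentCoeff z ((XA k I i).1 f) = laurentCoeff (z - Pi.single i 1) f := by
  induction f using MvPolynomial.induction_on' with
  | monomial m c =>
    rw [XA_apply_monomial, laurentCoeff_monomial, laurentCoeff_monomial]
    congr 1
    rw [eq_sub_iff_add_eq, eq_iff_iff]
    refine Eq.congr_left (funext fun j => ?_)
    by_cases h : j = i
    · subst h; simp
    · simp [h]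
  | add f g hf hg => rw [map_add, map_add, map_add, hf, hg]

open Classical in
theorem laurentCoeff_YA (i : I) (z : I → ℤ) (f : MvPolynomial I k) :
    laurentCoeff z ((YA k I i).1 f) = (z i + 1) * laurentCoeff (z + Pi.single i 1) f := by
  induction f using MvPolynomial.induction_on' with
  | monomial m c =>
    rw [YA_apply_monomial, laurentCoeff_monomial, laurentCoeff_monomial]
    by_cases hm : m i = 0
    · simp only [hm, Nat.cast_zero, mul_zero, ite_self]
      split_ifs with h
      · have := congrFun h i
        simp only [hm, Pi.add_apply, Pi.single_eq_same, Nat.cast_zero] at this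
        rw [show (z i : k) + 1 = ((z i + 1 : ℤ) : k) by push_cast; rfl, ← this]
        simp
      · simp
    · have key : ((fun j => ((m - Finsupp.single i 1 : I →₀ ℕ) j : ℤ)) = z) ↔
          (fun j => (m j : ℤ)) = z + Pi.single i 1 := by
        rw [← sub_eq_iff_eq_add]
        refine Eq.congr_left (funext fun j => ?_)
        by_cases h : j = i
        · subst h
          simp only [Finsupp.tsub_apply, Finsupp.single_eq_same, Pi.sub_apply, Pi.single_eq_same]
          omega
        · simp [h]
      simp only [key]
      split_ifs with h
      · have := congrFun h i
        simp only [Pi.add_apply, Pi.single_eq_same] at this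
        rw [show (z i : k) + 1 = ((z i + 1 : ℤ) : k) by push_cast; rfl, ← this]
        simp [mul_comm]
      · simp
  | add f g hf hg => rw [map_add, map_add, map_add, hf, hg, mul_add]

theorem exists_eval_eq_laurentCoeff (a : Weyl k I) (m : I → ℤ) :
    ∃ F : MvPolynomial I k, ∀ n : I →₀ ℕ,
      laurentCoeff (fun i => n i + m i) (a.1 (monomial n 1)) = eval (fun i => (n i : k)) F := by
  classical
  suffices h : ∀ (a b : Weyl k I), (∀ m : I → ℤ, ∃ F : MvPolynomial I k, ∀ n : I →₀ ℕ,
      laurentCoeff (fun i => n i + m i) (b.1 (monomial n 1)) = eval (fun i => (n i : k)) F) →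
      (∀ m : I → ℤ, ∃ F : MvPolynomial I k, ∀ n : I →₀ ℕ,
      laurentCoeff (fun i => n i + m i) ((a * b).1 (monomial n 1))
        = eval (fun i => (n i : k)) F) by
    have h1 := h a 1 (fun m => ⟨if m = 0 then 1 else 0, fun n => ?_⟩) m
    · simpa only [mul_one] using h1
    · change laurentCoeff _ (monomial n 1) = _
      rw [laurentCoeff_monomial]
      have : ((fun i => (n i : ℤ)) = fun i => n i + m i) ↔ m = 0 := by
        simp [funext_iff]
      simp only [this]
      split_ifs <;> simp
  intro a
  induction a using Weyl.induction with
  | hX i =>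
    intro b hb m
    obtain ⟨F, hF⟩ := hb (m - Pi.single i 1)
    refine ⟨F, fun n => ?_⟩
    rw [← hF]
    change laurentCoeff _ ((XA k I i).1 (b.1 _)) = _
    rw [laurentCoeff_XA]
    congr 2
    ext j
    simp [add_sub_assoc]
  | hY i =>
    intro b hb m
    obtain ⟨F, hF⟩ := hb (m + Pi.single i 1)
    refine ⟨(X i + C (m i : k) + 1) * F, fun n => ?_⟩
    rw [map_mul, ← hF]
    change laurentCoeff _ ((YA k I i).1 (b.1 _)) = _
    rw [laurentCoeff_YA]
    have : ((fun j => (n j : ℤ) + m j) + Pi.single i 1) =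
        fun j => (n j : ℤ) + (m + Pi.single i 1 : I → ℤ) j := by
      ext j
      simp [add_assoc]
    rw [this]
    simp
  | algebraMap c =>
    intro b hb m
    obtain ⟨F, hF⟩ := hb m
    refine ⟨C c * F, fun n => ?_⟩
    rw [map_mul, ← hF, ← Algebra.smul_def]
    change laurentCoeff _ (c • b.1 _) = _
    simp
  | add a a' h h' =>
    intro b hb m
    obtain ⟨F, hF⟩ := h b hb m
    obtain ⟨F', hF'⟩ := h' b hb m
    refine ⟨F + F', fun n => ?_⟩
    rw [map_add, ← hF, ← hF', add_mul, ← map_add]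
    rfl
  | mul a a' h h' =>
    intro b hb
    rw [mul_assoc]
    exact h _ (h' b hb)

/-- The diagonal coefficients of an element of the Weyl algebra depend polynomially on the
exponent. -/
theorem exists_eval_eq_coeff (a : Weyl k I) : ∃ F : MvPolynomial I k, ∀ n : I →₀ ℕ,
    coeff n (a.1 (monomial n 1)) = eval (fun i => (n i : k)) F := by
  obtain ⟨F, hF⟩ := exists_eval_eq_laurentCoeff a 0
  refine ⟨F, fun n => ?_⟩
  rw [← hF, ← laurentCoeff_natCast]
  simp

theorem eq_zero_of_eval_natCast [CharZero k] (F : MvPolynomial I k)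
    (h : ∀ n : I →₀ ℕ, eval (fun i => (n i : k)) F = 0) : F = 0 := by
  classical
  refine funext_set (fun _ => Set.range ((↑) : ℕ → k))
    (fun _ => Set.infinite_range_of_injective Nat.cast_injective) fun x hx => ?_
  choose y hy using fun i => hx i (Set.mem_univ i)
  rw [map_zero, ← h (Finsupp.onFinset F.vars (fun i => if i ∈ F.vars then y i else 0)
    (by simp +contextual))]
  refine hom_congr_vars (by ext; simp) (fun i hi _ => ?_) rfl
  simp [hi, hy]

theorem one_notMem_Jp [CharZero k] (p : I → k) : (1 : Weyl k I) ∉ Jp k I p := by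
  classical
  suffices h : ∀ a ∈ Jp k I p, ∃ F : MvPolynomial I k, eval p F = 0 ∧
      ∀ n : I →₀ ℕ, coeff n (a.1 (monomial n 1)) = eval (fun i => (n i : k)) F by
    intro h1
    obtain ⟨F, hp, hF⟩ := h 1 h1
    have h0 : F - 1 = 0 := eq_zero_of_eval_natCast _ fun n => by
      rw [map_sub, ← hF, map_one (eval _), OneMemClass.coe_one, Module.End.one_apply, coeff_monomial]
      simp
    rw [sub_eq_zero.1 h0] at hp
    simp at hp
  intro a ha
  obtain ⟨c, rfl⟩ := Finsupp.mem_span_range_iff_exists_finsupp.1 ha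
  induction c using Finsupp.induction_linear with
  | zero => exact ⟨0, by simp⟩
  | add c d hc hd =>
    obtain ⟨F, hp, hF⟩ := hc (Finsupp.mem_span_range_iff_exists_finsupp.2 ⟨c, rfl⟩)
    obtain ⟨G, hq, hG⟩ := hd (Finsupp.mem_span_range_iff_exists_finsupp.2 ⟨d, rfl⟩)
    refine ⟨F + G, by simp [hp, hq], fun n => ?_⟩
    rw [map_add, ← hF, ← hG, Finsupp.sum_add_index' (by simp) (by intros; rw [add_smul]),
      ← coeff_add]
    rfl
  | single i b =>
    obtain ⟨F, hF⟩ := exists_eval_eq_coeff b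
    refine ⟨F * (X i - C (p i)), by simp, fun n => ?_⟩
    rw [Finsupp.sum_single_index (by simp), map_mul, ← hF]
    change coeff n (b.1 ((tA k I i).1 (monomial n 1) - p i • monomial n 1)) = _
    rw [tA_apply_monomial, show (monomial n (1 * (n i : k)) : MvPolynomial I k)
      = (n i : k) • monomial n 1 by simp [smul_monomial], ← sub_smul, map_smul, coeff_smul]
    simp [mul_comm]

end Action

section Homogeneous

variable {k I}

theorem Weyl.mul_apply (a b : Weyl k I) (f : MvPolynomial I k) : (a * b).1 f = a.1 (b.1 f) :=
  rfl

theorem Weyl.add_algebraMap_apply (a : Weyl k I) (c : k) (f : MvPolynomial I k) :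
    (a + algebraMap k (Weyl k I) c).1 f = a.1 f + c • f :=
  rfl

/-- `a` is homogeneous of degree `n` for the adjoint action of the `t i`. -/
def IsHomog (a : Weyl k I) (n : I → k) : Prop :=
  ∀ i, tA k I i * a = a * (tA k I i + algebraMap k (Weyl k I) (n i))

theorem isHomog_algebraMap (c : k) : IsHomog (algebraMap k (Weyl k I) c) 0 := fun i => by
  simp [Algebra.commutes]

theorem IsHomog.mul {a b : Weyl k I} {m n : I → k} (ha : IsHomog a m) (hb : IsHomog b n) :
    IsHomog (a * b) (m + n) := fun i => by
  rw [← mul_assoc, ha i, mul_assoc, add_mul, hb i, Algebra.commutes, ← mul_add, ← mul_assoc]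
  simp only [Pi.add_apply, map_add]
  abel_nf

open Classical in
theorem isHomog_XA (j : I) : IsHomog (XA k I j) (Pi.single j 1) := fun i => by
  refine Weyl.ext_monomial fun n => ?_
  rw [Weyl.mul_apply, Weyl.mul_apply, Weyl.add_algebraMap_apply, map_add, map_smul,
    tA_apply_monomial, XA_apply_monomial, XA_apply_monomial, tA_apply_monomial, smul_monomial,
    ← map_add]
  by_cases h : i = j
  · subst h; simp
  · simp [h]

open Classical in
theorem isHomog_YA (j : I) : IsHomog (YA k I j) (Pi.single j (-1)) := fun i => by
  refine Weyl.ext_monomial fun n => ?_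
  rw [Weyl.mul_apply, Weyl.mul_apply, Weyl.add_algebraMap_apply, map_add, map_smul,
    tA_apply_monomial, YA_apply_monomial, YA_apply_monomial, tA_apply_monomial, smul_monomial,
    ← map_add]
  by_cases h : i = j
  · subst h
    by_cases h0 : n i = 0
    · simp [h0]
    · congr 1
      simp [Nat.cast_sub (Nat.one_le_iff_ne_zero.2 h0)]
      ring
  · simp [h, mul_comm]

theorem mem_span_isHomog (a : Weyl k I) :
    a ∈ Submodule.span k {a : Weyl k I | ∃ n, IsHomog a n} := by
  classical
  induction a using Weyl.induction with
  | hX i => exact Submodule.subset_span ⟨_, isHomog_XA i⟩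
  | hY i => exact Submodule.subset_span ⟨_, isHomog_YA i⟩
  | algebraMap c => exact Submodule.subset_span ⟨_, isHomog_algebraMap c⟩
  | add a b ha hb => exact add_mem ha hb
  | mul a b ha hb =>
    have h := Submodule.mul_mem_mul ha hb
    rw [Submodule.span_mul_span] at h
    refine Submodule.span_mono ?_ h
    rintro _ ⟨a, ⟨m, ha⟩, b, ⟨n, hb⟩, rfl⟩
    exact ⟨_, ha.mul hb⟩

theorem exists_diagonal (p : I → k) (F : MvPolynomial I k) : ∃ b : Weyl k I,
    (∀ n : I →₀ ℕ, b.1 (monomial n 1) = eval (fun i => (n i : k)) F • monomial n 1) ∧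
      b - algebraMap k (Weyl k I) (eval p F) ∈ Jp k I p := by
  induction F using MvPolynomial.induction_on with
  | C c => exact ⟨algebraMap k (Weyl k I) c, fun n => by simp [Algebra.algebraMap_eq_smul_one],
      by simp⟩
  | add F G hF hG =>
    obtain ⟨a, ha, ha'⟩ := hF
    obtain ⟨b, hb, hb'⟩ := hG
    refine ⟨a + b, fun n => ?_, ?_⟩
    · rw [map_add, add_smul, ← ha, ← hb]
      rfl
    · rw [map_add, map_add, add_sub_add_comm]
      exact add_mem ha' hb'
  | mul_X F i hF =>
    obtain ⟨b, hb, hb'⟩ := hF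
    refine ⟨b * tA k I i, fun n => ?_, ?_⟩
    · change b.1 ((tA k I i).1 _) = _
      rw [tA_apply_monomial, show (monomial n (1 * (n i : k)) : MvPolynomial I k)
        = (n i : k) • monomial n 1 by simp [smul_monomial], map_smul, hb, smul_smul]
      simp [mul_comm]
    · have h : b * tA k I i - algebraMap k (Weyl k I) (eval p (F * X i)) =
          b • (tA k I i - p i • (1 : Weyl k I)) +
            algebraMap k (Weyl k I) (p i) • (b - algebraMap k (Weyl k I) (eval p F)) := by
        simp only [map_mul, eval_X, smul_eq_mul, Algebra.smul_def, mul_one, mul_sub]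
        rw [Algebra.commutes (p i) b, Algebra.commutes (p i) (algebraMap k _ _)]
        abel
      rw [h]
      exact add_mem (Submodule.smul_mem _ _ (Submodule.subset_span ⟨i, rfl⟩))
        (Submodule.smul_mem _ _ hb')

theorem IsHomog.exists_sub_mem_Jp [CharZero k] {a : Weyl k I} (ha : IsHomog a 0) (p : I → k) :
    ∃ c : k, a - algebraMap k (Weyl k I) c ∈ Jp k I p := by
  classical
  obtain ⟨F, hF⟩ := exists_eval_eq_coeff a
  obtain ⟨b, hb, hb'⟩ := exists_diagonal p F
  have hab : a = b := by
    refine Weyl.ext_monomial fun n => ?_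
    rw [hb, ← hF]
    ext m
    rw [coeff_smul, coeff_monomial]
    split_ifs with h
    · simp [h]
    · obtain ⟨i, hi⟩ := DFunLike.ne_iff.1 h
      have h1 := congrArg (fun c : Weyl k I => coeff m (c.1 (monomial n 1))) (ha i)
      change coeff m ((tA k I i).1 (a.1 _)) =
        coeff m (a.1 ((tA k I i).1 _ + (0 : k) • _)) at h1
      rw [zero_smul, add_zero, coeff_tA_apply, tA_apply_monomial,
        show (monomial n (1 * (n i : k)) : MvPolynomial I k)
          = (n i : k) • monomial n 1 by simp [smul_monomial], map_smul, coeff_smul, smul_eq_mul,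
        ← sub_eq_zero, ← sub_mul, mul_eq_zero, sub_eq_zero, Nat.cast_inj] at h1
      simpa using h1.resolve_left (Ne.symm hi)
  exact ⟨_, hab ▸ hb'⟩

end Homogeneous

section WeightModules

variable {k I}

/-- The monoid generated by the elements `c • (t i - q)` normalized so as to act as the identity
on weight spaces of weight `p`. -/
def weightProj (p : I → k) : Submonoid (Weyl k I) :=
  Submonoid.closure {e | ∃ (i : I) (q c : k), c * (p i - q) = 1 ∧
    e = c • (tA k I i - algebraMap k (Weyl k I) q)}

variable {M : Type*} [AddCommGroup M] [Module k M] [Module (Weyl k I) M]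
  [IsScalarTower k (Weyl k I) M]

theorem smul_tA_sub_smul {q : I → k} {x : M} (hx : x ∈ wtSp k I M q) (i : I) (c r : k) :
    (c • (tA k I i - algebraMap k (Weyl k I) r)) • x = (c * (q i - r)) • x := by
  rw [smul_assoc, sub_smul, hx i, algebraMap_smul, ← sub_smul, smul_smul]

theorem weightProj_smul {p : I → k} {e : Weyl k I} (he : e ∈ weightProj p) {x : M}
    (hx : x ∈ wtSp k I M p) : e • x = x := by
  induction he using Submonoid.closure_induction with
  | mem e he =>
    obtain ⟨i, q, c, hc, rfl⟩ := he
    rw [smul_tA_sub_smul hx, hc, one_smul]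
  | one => exact one_smul _ _
  | mul a b _ _ ha hb => rw [mul_smul, hb, ha]

theorem weightProj_smul_mem {p q : I → k} {e : Weyl k I} (he : e ∈ weightProj p) {x : M}
    (hx : x ∈ wtSp k I M q) : e • x ∈ wtSp k I M q := by
  induction he using Submonoid.closure_induction generalizing x with
  | mem e he =>
    obtain ⟨i, q, c, hc, rfl⟩ := he
    rw [smul_tA_sub_smul hx]
    exact Submodule.smul_mem _ _ hx
  | one => rwa [one_smul]
  | mul a b _ _ ha hb => rw [mul_smul]; exact ha (hb hx)

theorem exists_weightProj_smul_eq_zero {p q : I → k} (hpq : q ≠ p) {x : M}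
    (hx : x ∈ wtSp k I M q) : ∃ e ∈ weightProj p, e • x = 0 := by
  obtain ⟨i, hi⟩ := Function.ne_iff.1 hpq
  refine ⟨_, Submonoid.subset_closure ⟨i, q i, (p i - q i)⁻¹,
    inv_mul_cancel₀ (sub_ne_zero.2 (Ne.symm hi)), rfl⟩, ?_⟩
  rw [smul_tA_sub_smul hx, sub_self, mul_zero, zero_smul]

variable (M) in
/-- The vectors with no component of weight `p`, described through `weightProj p`. -/
def awayFrom (p : I → k) : Submodule k M where
  carrier := {x | ∀ e ∈ weightProj p, ∃ e' ∈ weightProj p, e' • e • x = 0}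
  zero_mem' := fun e _ => ⟨1, one_mem _, by simp⟩
  add_mem' := by
    intro x y hx hy e he
    obtain ⟨a, ha, hax⟩ := hx e he
    obtain ⟨b, hb, hby⟩ := hy (a * e) (mul_mem ha he)
    refine ⟨b * a, mul_mem hb ha, ?_⟩
    rw [mul_smul] at hby
    rw [smul_add, smul_add, mul_smul, mul_smul, hax, hby, smul_zero, add_zero]
  smul_mem' := by
    intro c x hx e he
    obtain ⟨a, ha, hax⟩ := hx e he
    refine ⟨a, ha, ?_⟩
    rw [smul_comm e c x, smul_comm a c, hax, smul_zero]

theorem exists_smul_eq_zero_of_mem_awayFrom {p : I → k} {x : M} (hx : x ∈ awayFrom M p) :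
    ∃ e ∈ weightProj p, e • x = 0 := by
  simpa using hx 1 (one_mem _)

theorem wtSp_le_awayFrom {p q : I → k} (hpq : q ≠ p) : wtSp k I M q ≤ awayFrom M p :=
  fun _ hx _ he => exists_weightProj_smul_eq_zero hpq (weightProj_smul_mem he hx)

theorem eq_zero_of_mem_awayFrom {p : I → k} {x : M} (hx : x ∈ awayFrom M p)
    (hx' : x ∈ wtSp k I M p) : x = 0 := by
  obtain ⟨e, he, h⟩ := exists_smul_eq_zero_of_mem_awayFrom hx
  rwa [weightProj_smul he hx'] at h

theorem IsHomog.smul_mem {a : Weyl k I} {n p : I → k} (ha : IsHomog a n) {x : M}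
    (hx : x ∈ wtSp k I M p) : a • x ∈ wtSp k I M (p + n) := fun i => by
  rw [smul_smul, ha i, mul_smul, add_smul, hx i, algebraMap_smul, ← add_smul, smul_comm,
    Pi.add_apply]

theorem finrank_wtSp_eq_one {p : I → k} {v : M} (hv : v ∈ wtSp k I M p) (hv0 : v ≠ 0)
    (h : ∀ x ∈ wtSp k I M p, ∃ c : k, c • v = x) : Module.finrank k (wtSp k I M p) = 1 := by
  refine finrank_eq_one ⟨v, hv⟩ (fun h0 => hv0 (congrArg Subtype.val h0)) ?_
  rintro ⟨x, hx⟩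
  obtain ⟨c, hc⟩ := h x hx
  exact ⟨c, Subtype.ext hc⟩

end WeightModules

section UniversalModule

variable {k I}

/-- The class of `1` in `P(p)`. -/
def genP (p : I → k) : Weyl k I ⧸ Jp k I p := (Jp k I p).mkQ 1

theorem smul_genP (p : I → k) (a : Weyl k I) : a • genP p = (Jp k I p).mkQ a := by
  rw [genP, ← map_smul, smul_eq_mul, mul_one]

theorem genP_ne_zero [CharZero k] (p : I → k) : genP p ≠ 0 := fun h =>
  one_notMem_Jp p <| (Submodule.Quotient.mk_eq_zero _).1 h

theorem genP_mem_wtSp (p : I → k) : genP p ∈ wtSp k I (Weyl k I ⧸ Jp k I p) p := fun i => by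
  rw [← sub_eq_zero, ← algebraMap_smul (Weyl k I) (p i) (genP p), ← sub_smul, smul_genP]
  refine (Submodule.Quotient.mk_eq_zero _).2 (Submodule.subset_span ⟨i, ?_⟩)
  simp only [Algebra.algebraMap_eq_smul_one]

theorem exists_sub_smul_genP_mem [CharZero k] (p : I → k) (x : Weyl k I ⧸ Jp k I p) :
    ∃ c : k, x - c • genP p ∈ awayFrom (Weyl k I ⧸ Jp k I p) p := by
  obtain ⟨a, rfl⟩ := (Jp k I p).mkQ_surjective x
  rw [← smul_genP]
  induction mem_span_isHomog a using Submodule.span_induction with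
  | mem a ha =>
    obtain ⟨n, ha⟩ := ha
    by_cases hn : n = 0
    · subst hn
      obtain ⟨c, hc⟩ := ha.exists_sub_mem_Jp p
      refine ⟨c, ?_⟩
      rw [← algebraMap_smul (Weyl k I) c (genP p), ← sub_smul, smul_genP,
        Submodule.mkQ_apply, (Submodule.Quotient.mk_eq_zero _).2 hc]
      exact zero_mem _
    · refine ⟨0, ?_⟩
      rw [zero_smul, sub_zero]
      exact wtSp_le_awayFrom (by simpa using hn) (ha.smul_mem (genP_mem_wtSp p))
  | zero => exact ⟨0, by simp⟩
  | add a b _ _ ha hb =>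
    obtain ⟨c, hc⟩ := ha
    obtain ⟨d, hd⟩ := hb
    refine ⟨c + d, ?_⟩
    rw [add_smul, add_smul, add_sub_add_comm]
    exact add_mem hc hd
  | smul r a _ ha =>
    obtain ⟨c, hc⟩ := ha
    refine ⟨r * c, ?_⟩
    rw [smul_assoc, mul_smul, ← smul_sub]
    exact Submodule.smul_mem _ _ hc

theorem exists_smul_eq_smul_genP [CharZero k] (p : I → k) (x : Weyl k I ⧸ Jp k I p) :
    ∃ e ∈ weightProj p, ∃ c : k, e • x = c • genP p := by
  obtain ⟨c, hc⟩ := exists_sub_smul_genP_mem p x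
  obtain ⟨e, he, h⟩ := exists_smul_eq_zero_of_mem_awayFrom hc
  refine ⟨e, he, c, ?_⟩
  rw [smul_sub, smul_comm e c, weightProj_smul he (genP_mem_wtSp p), sub_eq_zero] at h
  exact h

theorem eq_top_of_genP_mem {p : I → k} {S : Submodule (Weyl k I) (Weyl k I ⧸ Jp k I p)}
    (h : genP p ∈ S) : S = ⊤ := by
  refine Submodule.eq_top_iff'.2 fun x => ?_
  obtain ⟨a, rfl⟩ := (Jp k I p).mkQ_surjective x
  rw [← smul_genP]
  exact S.smul_mem _ h

theorem smul_genP_mem_imp {p : I → k} {S : Submodule (Weyl k I) (Weyl k I ⧸ Jp k I p)} {c : k}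
    (hc : c ≠ 0) (h : c • genP p ∈ S) : genP p ∈ S := by
  have h1 := S.smul_mem (algebraMap k (Weyl k I) c⁻¹) h
  rwa [algebraMap_smul, smul_smul, inv_mul_cancel₀ hc, one_smul] at h1

theorem mem_awayFrom_of_mem [CharZero k] {p : I → k}
    {S : Submodule (Weyl k I) (Weyl k I ⧸ Jp k I p)} (hS : genP p ∉ S)
    {x : Weyl k I ⧸ Jp k I p} (hx : x ∈ S) : x ∈ awayFrom (Weyl k I ⧸ Jp k I p) p := by
  intro e _
  obtain ⟨e', he', c, h⟩ := exists_smul_eq_smul_genP p (e • x)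
  refine ⟨e', he', ?_⟩
  have hc : c = 0 := by
    by_contra hc
    exact hS (smul_genP_mem_imp hc (h ▸ S.smul_mem _ (S.smul_mem _ hx)))
  rw [h, hc, zero_smul]

theorem le_Np_iff [CharZero k] {p : I → k}
    {S : Submodule (Weyl k I) (Weyl k I ⧸ Jp k I p)} : S ≤ Np k I p ↔ genP p ∉ S := by
  have key : ∀ x ∈ Np k I p, x ∈ awayFrom (Weyl k I ⧸ Jp k I p) p := by
    intro x hx
    rw [Np, sSup_eq_iSup'] at hx
    induction hx using Submodule.iSup_induction' with
    | mem S x hx =>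
      exact mem_awayFrom_of_mem (fun h => genP_ne_zero p (S.2 _ h (genP_mem_wtSp p))) hx
    | zero => exact zero_mem _
    | add x y _ _ hx hy => exact add_mem hx hy
  refine ⟨fun h hg => genP_ne_zero p (eq_zero_of_mem_awayFrom (key _ (h hg)) (genP_mem_wtSp p)),
    fun h => le_sSup fun x hx hx' => eq_zero_of_mem_awayFrom (mem_awayFrom_of_mem h hx) hx'⟩

theorem genP_notMem_Np [CharZero k] (p : I → k) : genP p ∉ Np k I p :=
  le_Np_iff.1 le_rfl

theorem isCoatom_Np [CharZero k] (p : I → k) : IsCoatom (Np k I p) := by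
  refine ⟨fun h => genP_notMem_Np p (h ▸ Submodule.mem_top), fun S hS => eq_top_of_genP_mem ?_⟩
  by_contra h
  exact hS.not_ge (le_Np_iff.2 h)

theorem finrank_wtSp_Lp [CharZero k] (p : I → k) :
    Module.finrank k (wtSp k I (Lp k I p) p) = 1 := by
  have hmk (c : k) (x : Weyl k I ⧸ Jp k I p) :
      (Np k I p).mkQ (c • x) = c • (Np k I p).mkQ x := by
    rw [← algebraMap_smul (Weyl k I) c x, map_smul, algebraMap_smul]
  have hv : (Np k I p).mkQ (genP p) ∈ wtSp k I (Lp k I p) p := fun i => by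
    rw [← map_smul, genP_mem_wtSp p i, hmk]
  refine finrank_wtSp_eq_one hv
    (fun h => genP_notMem_Np p ((Submodule.Quotient.mk_eq_zero _).1 h)) fun x hx => ?_
  obtain ⟨y, rfl⟩ := (Np k I p).mkQ_surjective x
  obtain ⟨e, he, c, h⟩ := exists_smul_eq_smul_genP p y
  refine ⟨c, ?_⟩
  rw [← hmk, ← h, map_smul, weightProj_smul he hx]

theorem nonempty_equiv_Lp [CharZero k] {p : I → k} {M : Type*} [AddCommGroup M]
    [Module (Weyl k I) M] [Module k M] [IsScalarTower k (Weyl k I) M]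
    [IsSimpleModule (Weyl k I) M] (hM : wtSp k I M p ≠ ⊥) :
    Nonempty (M ≃ₗ[Weyl k I] Lp k I p) := by
  obtain ⟨w, hw, hw0⟩ := Submodule.exists_mem_ne_zero_of_ne_bot hM
  have hJ : Jp k I p ≤ LinearMap.ker (LinearMap.toSpanSingleton (Weyl k I) M w) := by
    refine Submodule.span_le.2 ?_
    rintro _ ⟨i, rfl⟩
    change (tA k I i - p i • (1 : Weyl k I)) • w = 0
    rw [sub_smul, hw i, smul_assoc, one_smul, sub_self]
  let f := (Jp k I p).liftQ _ hJ
  have hf : f (genP p) = w := one_smul _ w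
  have hsurj : Function.Surjective f :=
    LinearMap.surjective_of_ne_zero fun h => hw0 (by rw [← hf, h, LinearMap.zero_apply])
  have hker : LinearMap.ker f = Np k I p := by
    have hcoatom : IsCoatom (LinearMap.ker f) :=
      isSimpleModule_iff_isCoatom.1 (IsSimpleModule.congr (f.quotKerEquivOfSurjective hsurj))
    refine (hcoatom.le_iff.1 (le_Np_iff.2 fun h => ?_)).resolve_left (isCoatom_Np p).1 |>.symm
    exact hw0 (hf ▸ h)
  exact ⟨(f.quotKerEquivOfSurjective hsurj).symm.trans (Submodule.quotEquivOfEq _ _ hker)⟩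

end UniversalModule

/-- `L(p)` is a simple module with one-dimensional weight space of weight
`p`, and every simple weight module with nonzero weight space of weight `p` is isomorphic
to `L(p)`. -/
theorem Lp_simple_unique [IsAlgClosed k] [CharZero k] [Infinite I] (p : I → k) :
    IsSimpleModule (Weyl k I) (Lp k I p) ∧
    Module.finrank k (wtSp k I (Lp k I p) p) = 1 ∧
    (∀ (M : Type w) [AddCommGroup M] [Module (Weyl k I) M] [Module k M]
        [IsScalarTower k (Weyl k I) M],
      IsSimpleModule (Weyl k I) M →
      (⨆ q : I → k, wtSp k I M q) = ⊤ →
      wtSp k I M p ≠ ⊥ →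
      Nonempty (M ≃ₗ[Weyl k I] Lp k I p)) := by
  exact ⟨isSimpleModule_iff_isCoatom.2 (isCoatom_Np p), finrank_wtSp_Lp p,
    fun M _ _ _ _ _ _ hM => nonempty_equiv_Lp hM⟩
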